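/- Let f: Ω → ℝ be α-Hölder and suppose λ > 0 and a strictly positive α-Hölder function h satisfy L_f h = λ h; set f̄ = f + log h − log(h∘σ) − log λ, and let ν be a Borel probability measure on Ω with L_{f̄}* ν = ν. Then for every shift-invariant Borel probability measure μ on Ω, the limit lim_{n→∞} (1/n) H_{Λ_n}(μ | ν) exists in [0,+∞] and equals log λ − ∫_Ω f dμ − h^s(μ), where h^s(μ) is the specific entropy of μ relative to p (with the convention that the right-hand side is +∞ when h^s(μ) = −∞). -/

import Mathlib

open MeasureTheory Filter
open scoped Classical

noncomputable section

namespace Paper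

variable {A : Type*} [MetricSpace A] [CompactSpace A] [MeasurableSpace A] [BorelSpace A]

/-- The left shift `σ` on `Ω = Aᴺ`. -/
def shift (x : ℕ → A) : ℕ → A := fun n => x (n + 1)

/-- Prepend a symbol: `cons a x = (a, x₀, x₁, …)`. -/
def cons (a : A) (x : ℕ → A) : ℕ → A := fun n =>
  match n with
  | 0 => a
  | n + 1 => x n

/-- The metric `d_Ω` on `Ω`. -/
def dOmega (x y : ℕ → A) : ℝ :=
  ∑' n : ℕ, (1 / 2 : ℝ) ^ (n + 1) * (dist (x n) (y n) / (1 + dist (x n) (y n)))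

/-- `f` is `α`-Hölder with respect to `d_Ω`. -/
def IsHolder (α : ℝ) (f : (ℕ → A) → ℝ) : Prop :=
  ∃ C : ℝ, 0 ≤ C ∧ ∀ x y, |f x - f y| ≤ C * dOmega x y ^ α

/-- The Ruelle transfer operator with a priori measure `p`. -/
def ruelle (p : Measure A) (f φ : (ℕ → A) → ℝ) : (ℕ → A) → ℝ :=
  fun x => ∫ a, Real.exp (f (cons a x)) * φ (cons a x) ∂p

/-- The normalized potential `f̄ = f + log h - log (h ∘ σ) - log λ`. -/
def fbar (f h : (ℕ → A) → ℝ) (lam : ℝ) : (ℕ → A) → ℝ :=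
  fun x => f x + Real.log (h x) - Real.log (h (shift x)) - Real.log lam

/-- Projection on the first `n` coordinates. -/
def proj (n : ℕ) (x : ℕ → A) : Fin n → A := fun i => x i

/-- Relative entropy `H(μ|ν)` of two measures, with value `+∞` unless
`μ ≪ ν` and the entropy integral is finite. -/
def relEnt {X : Type*} [MeasurableSpace X] (μ ν : Measure X) : EReal :=
  if μ ≪ ν ∧ Integrable (fun x => Real.log (μ.rnDeriv ν x).toReal) μ then
    ((∫ x, Real.log (μ.rnDeriv ν x).toReal ∂μ : ℝ) : EReal)
  else ⊤

/-- Relative entropy `H_{Λ_n}(μ|ν)` on the σ-algebra of the first `n` coordinates. -/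
def relEntN (n : ℕ) (μ ν : Measure (ℕ → A)) : EReal :=
  relEnt (μ.map (proj n)) (ν.map (proj n))

/-- The entropy `H_{Λ_n}(μ) = -H_{Λ_n}(μ | pᴺ)` relative to the a priori measure `p`. -/
def finEnt (p : Measure A) (μ : Measure (ℕ → A)) (n : ℕ) : EReal :=
  - relEnt (μ.map (proj n)) (Measure.pi fun _ : Fin n => p)

/-- The specific entropy `h^s(μ) = lim_n H_{Λ_n}(μ)/n` (defined as a `limsup`,
which coincides with the limit whenever the latter exists). -/
def specEnt (p : Measure A) (μ : Measure (ℕ → A)) : EReal :=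
  Filter.atTop.limsup fun n : ℕ => ((n : ℝ)⁻¹ : EReal) * finEnt p μ n

/-- Birkhoff sum `S_n(f)`. -/
def birkhoff (n : ℕ) (f : (ℕ → A) → ℝ) (x : ℕ → A) : ℝ :=
  ∑ i ∈ Finset.range n, f (shift^[i] x)

/-- The configuration `x_{Λ_n} y_{Λ_n^c}`. -/
def concatAt (n : ℕ) (x y : ℕ → A) : ℕ → A := fun i => if i < n then x i else y i

/-- Concatenation of a finite word with a configuration. -/
def wordCons (n : ℕ) (a : Fin n → A) (x : ℕ → A) : ℕ → A :=
  fun i => if h : i < n then a ⟨i, h⟩ else x (i - n)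

set_option linter.unusedSectionVars false

open InformationTheory in
lemma relEnt_eq_klDiv {X : Type*} [MeasurableSpace X] (μ ν : Measure X)
    [IsProbabilityMeasure μ] [IsProbabilityMeasure ν] :
    relEnt μ ν = (klDiv μ ν : EReal) := by
  unfold relEnt
  split_ifs with H
  · rw [klDiv_of_ac_of_integrable H.1 H.2]
    have h0 := integral_llr_add_sub_measure_univ_nonneg H.1 H.2
    rw [EReal.coe_ennreal_ofReal, max_eq_left h0]
    simp [llr_def]
  · rw [klDiv_def, if_neg (by exact H)]
    rfl

/-- Tilting the reference measure by a bounded function shifts the relative entropy. -/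
lemma relEnt_tilted {X : Type*} [MeasurableSpace X] (μ ν : Measure X)
    [IsProbabilityMeasure μ] [IsProbabilityMeasure ν] {F : X → ℝ} (hF : Measurable F)
    {M : ℝ} (hM : ∀ x, |F x| ≤ M) (h1 : ∫ x, Real.exp (F x) ∂ν = 1) :
    relEnt μ (ν.tilted F) = relEnt μ ν + ((-∫ x, F x ∂μ : ℝ) : EReal) := by
  have hFμ : Integrable F μ := Integrable.of_bound hF.aestronglyMeasurable M (.of_forall hM)
  have hexp : Integrable (fun x => Real.exp (F x)) ν := by
    by_contra hc
    rw [integral_undef hc] at h1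
    exact zero_ne_one h1
  have hac : μ ≪ ν.tilted F ↔ μ ≪ ν :=
    ⟨fun H => H.trans (tilted_absolutelyContinuous ν F),
      fun H => H.trans (absolutelyContinuous_tilted hexp)⟩
  unfold relEnt
  by_cases H : μ ≪ ν
  · have hcongr := llr_tilted_right H hexp
    simp only [h1, Real.log_one, add_zero] at hcongr
    have hint : Integrable (llr μ (ν.tilted F)) μ ↔ Integrable (llr μ ν) μ := by
      rw [integrable_congr hcongr]
      exact ⟨fun h => (h.sub hFμ.neg).congr (.of_forall fun x => by simp), fun h => hFμ.neg.add h⟩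
    by_cases H2 : Integrable (llr μ ν) μ
    · rw [if_pos ⟨hac.2 H, hint.2 H2⟩, if_pos ⟨H, H2⟩, ← EReal.coe_add]
      have := integral_llr_tilted_right H hFμ hexp H2
      rw [h1, Real.log_one, add_zero] at this
      rw [← sub_eq_add_neg]
      exact congrArg _ this
    · rw [if_neg (fun h => H2 (hint.1 h.2)), if_neg (fun h => H2 h.2), EReal.top_add_coe]
  · rw [if_neg (fun h => H (hac.1 h.1)), if_neg (fun h => H h.1), EReal.top_add_coe]

open InformationTheory in
/-- Relative entropy with respect to a product measure is at least the sum of the relative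
entropies of the marginals. -/
lemma klDiv_fst_add_klDiv_snd_le {X Y : Type*} [MeasurableSpace X] [MeasurableSpace Y]
    [StandardBorelSpace Y] (ρ : Measure (X × Y)) [IsProbabilityMeasure ρ]
    (p : Measure X) (q : Measure Y) [IsProbabilityMeasure p] [IsProbabilityMeasure q] :
    klDiv ρ.fst p + klDiv ρ.snd q ≤ klDiv ρ (p.prod q) := by
  have : Nonempty Y := q.nonempty_of_neZero
  have h1 := klDiv_compProd_eq_add ρ.fst p ρ.condKernel (ProbabilityTheory.Kernel.const X q)
  rw [Measure.compProd_const, Measure.compProd_const, Measure.disintegrate] at h1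
  rw [h1]
  gcongr
  refine le_of_eq_of_le ?_ (klDiv_map_le ρ (ρ.fst.prod q) measurable_snd)
  rw [← Measure.snd, ← Measure.snd, Measure.snd_prod]

open scoped ENNReal in
/-- Fekete's lemma for superadditive sequences with values in `[0, ∞]`. -/
lemma tendsto_div_of_superadditive (u : ℕ → ℝ≥0∞) (hu : ∀ m n, u m + u n ≤ u (m + n)) :
    ∃ L, Tendsto (fun n => u n / n) atTop (nhds L) := by
  have hlow : ∀ m, m ≠ 0 → ∀ a, a < u m / m → ∀ᶠ n : ℕ in atTop, a < u n / n := by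
    intro m hm a ha
    by_cases htop : ∃ k, u k = ⊤
    · obtain ⟨k, hk⟩ := htop
      filter_upwards [eventually_ge_atTop k] with n hn
      have : u n = ⊤ := by
        obtain ⟨d, rfl⟩ := Nat.exists_eq_add_of_le hn
        have := hu k d
        rw [hk, top_add] at this
        exact top_le_iff.1 this
      rw [this, ENNReal.top_div_of_ne_top (ENNReal.natCast_ne_top n)]
      exact lt_top_of_lt ha
    · push Not at htop
      have hsub : Subadditive fun n => -(u n).toReal := by
        intro m n
        have := ENNReal.toReal_mono (htop _) (hu m n)
        rw [ENNReal.toReal_add (htop _) (htop _)] at this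
        linarith
      have key : ∀ n : ℕ, n ≠ 0 → (a < u n / n ↔ -(u n).toReal / n < -a.toReal) := by
        intro n hn
        have hfin : u n / n ≠ ⊤ := ENNReal.div_ne_top (htop n) (by exact_mod_cast hn)
        rw [← ENNReal.toReal_lt_toReal (lt_top_of_lt ha).ne hfin, ENNReal.toReal_div,
          ENNReal.toReal_natCast, neg_div, neg_lt_neg_iff]
      filter_upwards [hsub.eventually_div_lt_of_div_lt hm ((key m hm).1 ha),
        eventually_ge_atTop 1] with n hn hn1
      exact (key n (by omega)).2 hn
  refine ⟨⨆ m : {m : ℕ // m ≠ 0}, u m / (m : ℕ), tendsto_order.2 ⟨fun a ha => ?_, fun a ha => ?_⟩⟩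
  · obtain ⟨m, hm⟩ := lt_iSup_iff.1 ha
    exact hlow m m.2 a hm
  · filter_upwards [eventually_ge_atTop 1] with n hn
    exact (le_iSup (fun m : {m : ℕ // m ≠ 0} => u m / (m : ℕ)) ⟨n, by omega⟩).trans_lt ha

lemma continuous_shift : Continuous (shift (A := A)) :=
  continuous_pi fun n => continuous_apply (n + 1)

lemma continuous_cons : Continuous fun z : A × (ℕ → A) => cons z.1 z.2 := by
  refine continuous_pi fun n => ?_
  cases n with
  | zero => exact continuous_fst
  | succ n => exact (continuous_apply n).comp continuous_snd

lemma continuous_wordCons (n : ℕ) :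
    Continuous fun z : (Fin n → A) × (ℕ → A) => wordCons n z.1 z.2 := by
  refine continuous_pi fun i => ?_
  by_cases h : i < n
  · simp only [wordCons, h, dif_pos]
    exact (continuous_apply _).comp continuous_fst
  · simp only [wordCons, h, dif_neg, not_false_iff]
    exact (continuous_apply _).comp continuous_snd

lemma continuous_birkhoff (n : ℕ) {g : (ℕ → A) → ℝ} (hg : Continuous g) :
    Continuous (birkhoff n g) :=
  continuous_finsetSum _ fun i _ => hg.comp (continuous_shift.iterate i)

lemma measurable_proj (n : ℕ) : Measurable (proj (A := A) n) :=
  measurable_pi_lambda _ fun _ => measurable_pi_apply _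

lemma iterate_shift_apply (k : ℕ) (x : ℕ → A) (i : ℕ) : shift^[k] x i = x (i + k) := by
  induction k generalizing x with
  | zero => rfl
  | succ k ih =>
    rw [Function.iterate_succ_apply, ih]
    simp [shift, add_assoc]

lemma shift_cons (a : A) (x : ℕ → A) : shift (cons a x) = x := rfl

lemma wordCons_zero (a : Fin 0 → A) (x : ℕ → A) : wordCons 0 a x = x := by
  funext i
  simp [wordCons]

lemma wordCons_succ (n : ℕ) (a : Fin (n + 1) → A) (x : ℕ → A) :
    wordCons (n + 1) a x = cons (a 0) (wordCons n (fun i => a i.succ) x) := by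
  funext i
  cases i with
  | zero => simp [wordCons, cons]
  | succ i => by_cases h : i < n <;> simp [wordCons, cons, h]

lemma proj_wordCons (n : ℕ) (a : Fin n → A) (x : ℕ → A) : proj n (wordCons n a x) = a := by
  funext i
  simp [proj, wordCons]

lemma wordCons_proj_apply {n i : ℕ} (hi : i < n) (x y : ℕ → A) :
    wordCons n (proj n x) y i = x i := by
  simp [wordCons, proj, hi]

lemma birkhoff_succ_cons (n : ℕ) (g : (ℕ → A) → ℝ) (a : A) (x : ℕ → A) :
    birkhoff (n + 1) g (cons a x) = g (cons a x) + birkhoff n g x := by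
  rw [birkhoff, Finset.sum_range_succ']
  simp [birkhoff, Function.iterate_succ_apply, shift_cons, add_comm]

lemma IsHolder.continuous {α : ℝ} (hα : 0 < α) {f : (ℕ → A) → ℝ} (hf : IsHolder α f) :
    Continuous f := by
  obtain ⟨C, -, hC⟩ := hf
  refine continuous_iff_continuousAt.2 fun x => ?_
  have hd : Continuous fun y : ℕ → A => dOmega y x := by
    unfold dOmega
    refine continuous_tsum (u := fun n : ℕ => (1 / 2 : ℝ) ^ (n + 1)) (fun n => ?_) ?_ ?_
    · have h1 : Continuous fun y : ℕ → A => dist (y n) (x n) :=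
        (continuous_apply n).dist continuous_const
      refine continuous_const.mul (h1.div (continuous_const.add h1) fun y => ?_)
      have : 0 ≤ dist (y n) (x n) := dist_nonneg
      positivity
    · exact (summable_nat_add_iff 1).2 summable_geometric_two
    · intro n y
      have h0 : 0 ≤ dist (y n) (x n) := dist_nonneg
      rw [Real.norm_of_nonneg (by positivity)]
      refine mul_le_of_le_one_right (by positivity) ?_
      rw [div_le_one (by positivity)]
      linarith
  have hlim : Tendsto (fun y => C * dOmega y x ^ α) (nhds x) (nhds 0) := by
    have h0 : dOmega x x = 0 := by simp [dOmega]
    have : ContinuousAt (fun y => C * dOmega y x ^ α) x :=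
      continuousAt_const.mul (hd.continuousAt.rpow_const (Or.inr hα.le))
    simpa [ContinuousAt, h0, Real.zero_rpow hα.ne'] using this
  rw [ContinuousAt, tendsto_iff_dist_tendsto_zero]
  exact squeeze_zero (fun _ => dist_nonneg) (fun y => hC y x) hlim

/-- A continuous function on `Ω` depends up to `ε` only on finitely many coordinates. -/
lemma exists_forall_agree_abs_sub_lt {g : (ℕ → A) → ℝ} (hg : Continuous g) {ε : ℝ} (hε : 0 < ε) :
    ∃ K : ℕ, ∀ x y : ℕ → A, (∀ i < K, x i = y i) → |g x - g y| < ε := by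
  have hu := CompactSpace.uniformContinuous_of_continuous hg
  have hmem := hu (Metric.dist_mem_uniformity hε)
  rw [Pi.uniformity, Filter.mem_map, Filter.mem_iInf] at hmem
  obtain ⟨I, hI, V, hV, hVeq⟩ := hmem
  obtain ⟨K, hK⟩ := hI.bddAbove
  refine ⟨K + 1, fun x y hxy => ?_⟩
  have : (x, y) ∈ ⋂ i, V i := by
    refine Set.mem_iInter.2 fun i => ?_
    obtain ⟨U, hU, hUV⟩ := hV i
    refine hUV ?_
    change (x i, y i) ∈ U
    rw [hxy i (Nat.lt_succ_of_le (hK i.2))]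
    exact refl_mem_uniformity hU
  rw [← hVeq] at this
  exact this

/-- The variation of Birkhoff sums of a continuous function on cylinders of length `n` is
sublinear in `n`. -/
lemma exists_forall_agree_abs_birkhoff_sub_le {g : (ℕ → A) → ℝ} (hg : Continuous g) {ε : ℝ}
    (hε : 0 < ε) :
    ∃ C : ℝ, ∀ (n : ℕ) (x y : ℕ → A), (∀ i < n, x i = y i) →
      |birkhoff n g x - birkhoff n g y| ≤ n * ε + C := by
  obtain ⟨K, hK⟩ := exists_forall_agree_abs_sub_lt hg hε
  obtain ⟨M, hM⟩ := isCompact_univ.exists_bound_of_continuousOn hg.continuousOn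
  have hM0 : ∀ x, 0 ≤ M := fun x => (norm_nonneg _).trans (hM x (Set.mem_univ x))
  refine ⟨K * (2 * M), fun n x y hxy => ?_⟩
  have hterm : ∀ i ∈ Finset.range n, |g (shift^[i] x) - g (shift^[i] y)|
      ≤ ε + if n < i + K then 2 * M else 0 := by
    intro i hi
    rw [Finset.mem_range] at hi
    split_ifs with h
    · have h1 := abs_sub (g (shift^[i] x)) (g (shift^[i] y))
      have h2 := hM (shift^[i] x) (Set.mem_univ _)
      have h3 := hM (shift^[i] y) (Set.mem_univ _)
      rw [Real.norm_eq_abs] at h2 h3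
      linarith
    · rw [add_zero]
      refine (hK _ _ fun j hj => ?_).le
      rw [iterate_shift_apply, iterate_shift_apply]
      exact hxy _ (by omega)
  have hcard : ((Finset.range n).filter fun i => n < i + K).card ≤ K := by
    calc _ ≤ (Finset.Ico (n - K) n).card := by
          refine Finset.card_le_card fun i hi => ?_
          simp only [Finset.mem_filter, Finset.mem_range, Finset.mem_Ico] at hi ⊢
          omega
      _ ≤ K := by
          rw [Nat.card_Ico]
          omega
  calc |birkhoff n g x - birkhoff n g y|
      = |∑ i ∈ Finset.range n, (g (shift^[i] x) - g (shift^[i] y))| := by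
        rw [Finset.sum_sub_distrib]; rfl
    _ ≤ ∑ i ∈ Finset.range n, |g (shift^[i] x) - g (shift^[i] y)| :=
        Finset.abs_sum_le_sum_abs _ _
    _ ≤ ∑ i ∈ Finset.range n, (ε + if n < i + K then 2 * M else 0) := Finset.sum_le_sum hterm
    _ = n * ε + ((Finset.range n).filter fun i => n < i + K).card * (2 * M) := by
        rw [Finset.sum_add_distrib, ← Finset.sum_filter]
        simp
    _ ≤ n * ε + K * (2 * M) := by
        have := hM0 x
        gcongr

/-- If `G` is uniformly within `r` of `c`, then so is the logarithm of the mean of `exp G`. -/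
lemma abs_log_integral_exp_sub_le {X : Type*} [MeasurableSpace X] (ν : Measure X)
    [IsProbabilityMeasure ν] {G : X → ℝ} (hG : Measurable G) {c r : ℝ}
    (h : ∀ x, |G x - c| ≤ r) : |Real.log (∫ x, Real.exp (G x) ∂ν) - c| ≤ r := by
  have hlo : ∀ x, Real.exp (c - r) ≤ Real.exp (G x) := fun x =>
    Real.exp_le_exp.2 (by linarith [(abs_le.1 (h x)).1])
  have hhi : ∀ x, Real.exp (G x) ≤ Real.exp (c + r) := fun x =>
    Real.exp_le_exp.2 (by linarith [(abs_le.1 (h x)).2])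
  have hint : Integrable (fun x => Real.exp (G x)) ν :=
    Integrable.of_bound (Real.measurable_exp.comp hG).aestronglyMeasurable (Real.exp (c + r))
      (.of_forall fun x => by rw [Real.norm_of_nonneg (Real.exp_pos _).le]; exact hhi x)
  have h1 : Real.exp (c - r) ≤ ∫ x, Real.exp (G x) ∂ν := by
    simpa using integral_mono (integrable_const (μ := ν) (Real.exp (c - r))) hint hlo
  have h2 : ∫ x, Real.exp (G x) ∂ν ≤ Real.exp (c + r) := by
    simpa using integral_mono hint (integrable_const (μ := ν) (Real.exp (c + r))) hhi
  have hpos := (Real.exp_pos _).trans_le h1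
  rw [abs_le]
  constructor
  · linarith [(Real.le_log_iff_exp_le hpos).2 h1]
  · linarith [(Real.log_le_iff_le_exp hpos).2 h2]

lemma continuous_birkhoff_wordCons (n : ℕ) {g : (ℕ → A) → ℝ} (hg : Continuous g)
    (a : Fin n → A) : Continuous fun x => birkhoff n g (wordCons n a x) := by
  have hw : Continuous fun x : ℕ → A => wordCons n a x :=
    (continuous_wordCons n).comp (Continuous.prodMk_right a)
  exact (continuous_birkhoff n hg).comp hw

section Measure

variable [SecondCountableTopology A]

lemma lintegral_eq_lintegral_cons (p : Measure A) [IsProbabilityMeasure p]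
    {g : (ℕ → A) → ℝ} (hg : Continuous g) (ν : Measure (ℕ → A)) [IsProbabilityMeasure ν]
    (hν : ∀ φ : (ℕ → A) → ℝ, Continuous φ → ∫ x, ruelle p g φ x ∂ν = ∫ x, φ x ∂ν)
    {φ : (ℕ → A) → ENNReal} (hφ : Measurable φ) :
    ∫⁻ x, φ x ∂ν
      = ∫⁻ x, ∫⁻ a, ENNReal.ofReal (Real.exp (g (cons a x))) * φ (cons a x) ∂p ∂ν := by
  have hc : Continuous fun z : (ℕ → A) × A => cons z.2 z.1 :=
    continuous_cons.comp continuous_swap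
  have hw : Measurable fun z : (ℕ → A) × A => ENNReal.ofReal (Real.exp (g (cons z.2 z.1))) :=
    (ENNReal.continuous_ofReal.comp (Real.continuous_exp.comp (hg.comp hc))).measurable
  have hform : ∀ ψ : (ℕ → A) → ENNReal, Measurable ψ →
      ∫⁻ x, ψ x ∂((ν.prod p).withDensity
        (fun z => ENNReal.ofReal (Real.exp (g (cons z.2 z.1))))).map (fun z => cons z.2 z.1)
      = ∫⁻ x, ∫⁻ a, ENNReal.ofReal (Real.exp (g (cons a x))) * ψ (cons a x) ∂p ∂ν := by
    intro ψ hψ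
    rw [lintegral_map hψ hc.measurable]
    refine (lintegral_withDensity_eq_lintegral_mul _ hw (hψ.comp hc.measurable)).trans ?_
    exact lintegral_prod _ (hw.mul (hψ.comp hc.measurable)).aemeasurable
  rw [← hform φ hφ]
  congr 1
  refine ext_of_forall_lintegral_eq_of_IsFiniteMeasure fun ψ => ?_
  rw [hform _ (by fun_prop)]
  have hψc : Continuous fun x => (ψ x : ℝ) := NNReal.continuous_coe.comp ψ.continuous
  obtain ⟨M, hM⟩ := isCompact_univ.exists_bound_of_continuousOn
    (((Real.continuous_exp.comp hg).mul hψc).continuousOn)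
  have hbound : ∀ x, Real.exp (g x) * ψ x ≤ M := fun x =>
    (Real.le_norm_self _).trans (hM x (Set.mem_univ x))
  have hin : ∀ x, Integrable (fun a => Real.exp (g (cons a x)) * (ψ (cons a x) : ℝ)) p := by
    intro x
    have hcx : Continuous fun a => cons a x :=
      continuous_cons.comp (continuous_id.prodMk continuous_const)
    refine Integrable.of_bound (C := M)
      (((Real.continuous_exp.comp hg).mul hψc).comp hcx).aestronglyMeasurable
      (.of_forall fun a => hM _ (Set.mem_univ _))
  have hinner : ∀ x, ∫⁻ a, ENNReal.ofReal (Real.exp (g (cons a x))) * (ψ (cons a x) : ENNReal) ∂p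
      = ENNReal.ofReal (ruelle p g (fun x => ψ x) x) := by
    intro x
    rw [ruelle, ofReal_integral_eq_lintegral_ofReal (hin x) (.of_forall fun a => by positivity)]
    refine lintegral_congr fun a => ?_
    rw [ENNReal.ofReal_mul (Real.exp_pos _).le, ENNReal.ofReal_coe_nnreal]
  simp_rw [hinner]
  have hrm : StronglyMeasurable (ruelle p g (fun x => (ψ x : ℝ))) :=
    (((Real.continuous_exp.comp hg).mul hψc).comp hc).stronglyMeasurable.integral_prod_right'
  have hr0 : ∀ x, 0 ≤ ruelle p g (fun x => (ψ x : ℝ)) x := fun x =>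
    integral_nonneg fun a => by positivity
  have hri : Integrable (ruelle p g (fun x => (ψ x : ℝ))) ν := by
    refine Integrable.of_bound hrm.aestronglyMeasurable M (.of_forall fun x => ?_)
    rw [Real.norm_of_nonneg (hr0 x)]
    have := integral_mono (hin x) (integrable_const (μ := p) M) fun a => hbound (cons a x)
    rwa [integral_const, probReal_univ, one_smul] at this
  rw [← ofReal_integral_eq_lintegral_ofReal hri (.of_forall hr0), hν _ hψc,
    ofReal_integral_eq_lintegral_ofReal _ (.of_forall fun x => NNReal.coe_nonneg _)]
  · simp
  · obtain ⟨N, hN⟩ := isCompact_univ.exists_bound_of_continuousOn hψc.continuousOn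
    exact Integrable.of_bound hψc.aestronglyMeasurable N (.of_forall fun x => hN x (Set.mem_univ x))

lemma lintegral_pi_succ (p : Measure A) [IsProbabilityMeasure p] (n : ℕ)
    {F : (Fin (n + 1) → A) → ENNReal} (hF : Measurable F) :
    ∫⁻ a, F a ∂(Measure.pi fun _ => p)
      = ∫⁻ a, ∫⁻ b, F (Fin.cons b a) ∂p ∂(Measure.pi fun _ => p) := by
  have hmp := (measurePreserving_piFinSuccAbove (fun _ : Fin (n + 1) => p) 0).symm
  rw [← hmp.lintegral_comp hF]
  refine (lintegral_prod_symm' _ (hF.comp (MeasurableEquiv.measurable _))).trans ?_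
  refine lintegral_congr fun a => lintegral_congr fun b => ?_
  simp [MeasurableEquiv.piFinSuccAbove]
  rfl

lemma lintegral_eq_lintegral_wordCons (p : Measure A) [IsProbabilityMeasure p]
    {g : (ℕ → A) → ℝ} (hg : Continuous g) (ν : Measure (ℕ → A)) [IsProbabilityMeasure ν]
    (hν : ∀ φ : (ℕ → A) → ℝ, Continuous φ → ∫ x, ruelle p g φ x ∂ν = ∫ x, φ x ∂ν)
    (n : ℕ) {φ : (ℕ → A) → ENNReal} (hφ : Measurable φ) :
    ∫⁻ x, φ x ∂ν = ∫⁻ x, ∫⁻ a, ENNReal.ofReal (Real.exp (birkhoff n g (wordCons n a x)))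
      * φ (wordCons n a x) ∂(Measure.pi fun _ => p) ∂ν := by
  induction n generalizing φ with
  | zero => simp [wordCons_zero, birkhoff]
  | succ n ih =>
    have hw : ∀ m, Measurable fun x => ENNReal.ofReal (Real.exp (birkhoff m g x)) := fun m =>
      (ENNReal.continuous_ofReal.comp
        (Real.continuous_exp.comp (continuous_birkhoff m hg))).measurable
    have hwg : Measurable fun x => ENNReal.ofReal (Real.exp (g x)) :=
      (ENNReal.continuous_ofReal.comp (Real.continuous_exp.comp hg)).measurable
    have hcons : Measurable fun z : (ℕ → A) × A => cons z.2 z.1 :=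
      (continuous_cons.comp continuous_swap).measurable
    rw [lintegral_eq_lintegral_cons p hg ν hν hφ, ih]
    · refine lintegral_congr fun x => ?_
      have hwc : Continuous fun a : Fin (n + 1) → A => wordCons (n + 1) a x :=
        (continuous_wordCons (n + 1)).comp (continuous_id.prodMk continuous_const)
      refine Eq.trans ?_
        (lintegral_pi_succ _ _ (((hw (n + 1)).mul hφ).comp hwc.measurable)).symm
      refine lintegral_congr fun a => ?_
      rw [← lintegral_const_mul]
      · refine lintegral_congr fun b => ?_
        simp only [Function.comp, Pi.mul_apply, wordCons_succ, Fin.cons_zero, Fin.cons_succ,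
          birkhoff_succ_cons, Real.exp_add]
        rw [ENNReal.ofReal_mul (Real.exp_pos _).le]
        ring
      · exact (hwg.mul hφ).comp (hcons.comp measurable_prodMk_left)
    · exact ((hwg.mul hφ).comp hcons).lintegral_prod_right'

/-- The logarithm of the density of the `n`-th marginal of `ν` with respect to `p^n`. -/
def logDensity (ν : Measure (ℕ → A)) (g : (ℕ → A) → ℝ) (n : ℕ) (a : Fin n → A) : ℝ :=
  Real.log (∫ x, Real.exp (birkhoff n g (wordCons n a x)) ∂ν)

lemma measurable_logDensity (ν : Measure (ℕ → A)) [IsProbabilityMeasure ν] {g : (ℕ → A) → ℝ}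
    (hg : Continuous g) (n : ℕ) : Measurable (logDensity ν g n) := by
  refine Real.measurable_log.comp (StronglyMeasurable.measurable ?_)
  exact (Real.continuous_exp.comp ((continuous_birkhoff n hg).comp
    (continuous_wordCons n))).stronglyMeasurable.integral_prod_right'

lemma exists_bound_logDensity (ν : Measure (ℕ → A)) [IsProbabilityMeasure ν] {g : (ℕ → A) → ℝ}
    (hg : Continuous g) (n : ℕ) : ∃ M, ∀ a, |logDensity ν g n a| ≤ M := by
  obtain ⟨M, hM⟩ :=
    isCompact_univ.exists_bound_of_continuousOn (continuous_birkhoff n hg).continuousOn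
  refine ⟨M, fun a => ?_⟩
  have hm := continuous_birkhoff_wordCons n hg a
  simpa [logDensity] using abs_log_integral_exp_sub_le ν hm.measurable (c := 0) (r := M)
    fun x => by simpa using hM _ (Set.mem_univ _)

lemma exp_logDensity (ν : Measure (ℕ → A)) [IsProbabilityMeasure ν] {g : (ℕ → A) → ℝ}
    (hg : Continuous g) (n : ℕ) (a : Fin n → A) :
    ENNReal.ofReal (Real.exp (logDensity ν g n a))
      = ∫⁻ x, ENNReal.ofReal (Real.exp (birkhoff n g (wordCons n a x))) ∂ν := by
  have hm : Continuous fun x => Real.exp (birkhoff n g (wordCons n a x)) :=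
    Real.continuous_exp.comp (continuous_birkhoff_wordCons n hg a)
  obtain ⟨M, hM⟩ := isCompact_univ.exists_bound_of_continuousOn hm.continuousOn
  have hint : Integrable (fun x => Real.exp (birkhoff n g (wordCons n a x))) ν :=
    Integrable.of_bound hm.aestronglyMeasurable M (.of_forall fun x => hM x (Set.mem_univ x))
  rw [logDensity, Real.exp_log (integral_exp_pos hint),
    ofReal_integral_eq_lintegral_ofReal hint (.of_forall fun x => (Real.exp_pos _).le)]

lemma map_proj_eq_withDensity (p : Measure A) [IsProbabilityMeasure p]
    {g : (ℕ → A) → ℝ} (hg : Continuous g) (ν : Measure (ℕ → A)) [IsProbabilityMeasure ν]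
    (hν : ∀ φ : (ℕ → A) → ℝ, Continuous φ → ∫ x, ruelle p g φ x ∂ν = ∫ x, φ x ∂ν) (n : ℕ) :
    ν.map (proj n) = (Measure.pi fun _ => p).withDensity
      fun a => ENNReal.ofReal (Real.exp (logDensity ν g n a)) := by
  have hw : Measurable fun z : (ℕ → A) × (Fin n → A) =>
      ENNReal.ofReal (Real.exp (birkhoff n g (wordCons n z.2 z.1))) :=
    (ENNReal.continuous_ofReal.comp (Real.continuous_exp.comp ((continuous_birkhoff n hg).comp
      ((continuous_wordCons n).comp continuous_swap)))).measurable
  refine Measure.ext_of_lintegral _ fun φ hφ => ?_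
  rw [lintegral_map hφ (measurable_proj n), lintegral_eq_lintegral_wordCons p hg ν hν n
    (φ := fun x => φ (proj n x)) (hφ.comp (measurable_proj n)), lintegral_withDensity_eq_lintegral_mul _
    (by have := measurable_logDensity ν hg n; fun_prop) hφ]
  simp only [proj_wordCons, Pi.mul_apply, exp_logDensity ν hg]
  rw [lintegral_lintegral_swap]
  · refine lintegral_congr fun a => ?_
    have hwa : Measurable fun x => ENNReal.ofReal (Real.exp (birkhoff n g (wordCons n a x))) :=
      (ENNReal.continuous_ofReal.comp
        (Real.continuous_exp.comp (continuous_birkhoff_wordCons n hg a))).measurable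
    exact lintegral_mul_const _ hwa
  · have hφs : Measurable fun z : (ℕ → A) × (Fin n → A) => φ z.2 := hφ.comp measurable_snd
    exact (hw.mul hφs).aemeasurable

lemma integral_exp_logDensity (p : Measure A) [IsProbabilityMeasure p]
    {g : (ℕ → A) → ℝ} (hg : Continuous g) (ν : Measure (ℕ → A)) [IsProbabilityMeasure ν]
    (hν : ∀ φ : (ℕ → A) → ℝ, Continuous φ → ∫ x, ruelle p g φ x ∂ν = ∫ x, φ x ∂ν) (n : ℕ) :
    ∫ a, Real.exp (logDensity ν g n a) ∂(Measure.pi fun _ => p) = 1 := by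
  have h := congrArg (fun m => m Set.univ) (map_proj_eq_withDensity p hg ν hν n)
  have : IsProbabilityMeasure (ν.map (proj n)) :=
    Measure.isProbabilityMeasure_map (measurable_proj n).aemeasurable
  simp only [measure_univ, withDensity_apply _ MeasurableSet.univ, Measure.restrict_univ] at h
  have hm := measurable_logDensity ν hg n
  rw [integral_eq_lintegral_of_nonneg_ae (.of_forall fun a => (Real.exp_pos _).le)
    (by fun_prop), ← h, ENNReal.toReal_one]

lemma relEntN_eq (p : Measure A) [IsProbabilityMeasure p]
    {g : (ℕ → A) → ℝ} (hg : Continuous g) (ν : Measure (ℕ → A)) [IsProbabilityMeasure ν]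
    (hν : ∀ φ : (ℕ → A) → ℝ, Continuous φ → ∫ x, ruelle p g φ x ∂ν = ∫ x, φ x ∂ν)
    (μ : Measure (ℕ → A)) [IsProbabilityMeasure μ] (n : ℕ) :
    relEntN n μ ν = relEnt (μ.map (proj n)) (Measure.pi fun _ : Fin n => p)
      + ((-∫ x, logDensity ν g n (proj n x) ∂μ : ℝ) : EReal) := by
  have : IsProbabilityMeasure (μ.map (proj n)) :=
    Measure.isProbabilityMeasure_map (measurable_proj n).aemeasurable
  have hm := measurable_logDensity ν hg n
  have h1 := integral_exp_logDensity p hg ν hν n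
  obtain ⟨M, hM⟩ := exists_bound_logDensity ν hg n
  have ht : ν.map (proj n) = (Measure.pi fun _ => p).tilted (logDensity ν g n) := by
    rw [Measure.tilted, h1, map_proj_eq_withDensity p hg ν hν n]
    simp
  rw [relEntN, ht, relEnt_tilted _ _ hm hM h1,
    integral_map (measurable_proj n).aemeasurable hm.aestronglyMeasurable]

lemma measurable_finAppend (m n : ℕ) :
    Measurable fun z : (Fin m → A) × (Fin n → A) => Fin.append z.1 z.2 := by
  refine measurable_pi_lambda _ fun i => ?_
  refine Fin.addCases (fun j => ?_) (fun j => ?_) i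
  · simp only [Fin.append_left]
    fun_prop
  · simp only [Fin.append_right]
    fun_prop

lemma map_pi_append (p : Measure A) [IsProbabilityMeasure p] (m n : ℕ) :
    ((Measure.pi fun _ : Fin m => p).prod (Measure.pi fun _ : Fin n => p)).map
      (fun z => Fin.append z.1 z.2) = Measure.pi fun _ : Fin (m + n) => p := by
  refine (Measure.pi_eq fun s hs => ?_).symm
  have hpre : (fun z : (Fin m → A) × (Fin n → A) => Fin.append z.1 z.2) ⁻¹' Set.univ.pi s
      = (Set.univ.pi fun i => s (Fin.castAdd n i)) ×ˢ (Set.univ.pi fun j => s (Fin.natAdd m j)) := by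
    ext z
    simp only [Set.mem_preimage, Set.mem_prod, Set.mem_univ_pi]
    constructor
    · intro h
      exact ⟨fun i => by simpa using h (Fin.castAdd n i), fun j => by simpa using h (Fin.natAdd m j)⟩
    · rintro ⟨h1, h2⟩ i
      refine Fin.addCases (fun j => ?_) (fun j => ?_) i
      · simpa using h1 j
      · simpa using h2 j
  rw [Measure.map_apply (measurable_finAppend m n) (MeasurableSet.univ_pi hs), hpre, Measure.prod_prod,
    Measure.pi_pi, Measure.pi_pi, Fin.prod_univ_add]

lemma measurePreserving_iterate_shift {μ : Measure (ℕ → A)} (hinv : μ.map shift = μ) (k : ℕ) :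
    MeasurePreserving (shift^[k]) μ μ :=
  MeasurePreserving.iterate ⟨continuous_shift.measurable, hinv⟩ k

open InformationTheory in
/-- The relative entropies of the marginals of a shift-invariant measure with respect to a product
measure are superadditive. -/
lemma klDiv_proj_add_le (p : Measure A) [IsProbabilityMeasure p] (μ : Measure (ℕ → A))
    [IsProbabilityMeasure μ] (hinv : μ.map shift = μ) (m n : ℕ) :
    klDiv (μ.map (proj m)) (Measure.pi fun _ => p) + klDiv (μ.map (proj n)) (Measure.pi fun _ => p)
      ≤ klDiv (μ.map (proj (m + n))) (Measure.pi fun _ => p) := by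
  have : IsProbabilityMeasure (μ.map (proj (m + n))) :=
    Measure.isProbabilityMeasure_map (measurable_proj (m + n)).aemeasurable
  let e : (Fin (m + n) → A) → (Fin m → A) × (Fin n → A) := fun x =>
    (fun i => x (Fin.castAdd n i), fun j => x (Fin.natAdd m j))
  have he : Measurable e := by fun_prop
  have hpi : (Measure.pi fun _ : Fin (m + n) => p).map e
      = (Measure.pi fun _ : Fin m => p).prod (Measure.pi fun _ : Fin n => p) := by
    rw [← map_pi_append, Measure.map_map he (measurable_finAppend m n)]
    convert Measure.map_id
    ext z i <;> simp [e]
  have h1 : ((μ.map (proj (m + n))).map e).fst = μ.map (proj m) := by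
    rw [Measure.fst, Measure.map_map he (measurable_proj _),
      Measure.map_map measurable_fst (he.comp (measurable_proj _))]
    rfl
  have h2 : ((μ.map (proj (m + n))).map e).snd = μ.map (proj n) := by
    rw [Measure.snd, Measure.map_map he (measurable_proj _),
      Measure.map_map measurable_snd (he.comp (measurable_proj _))]
    have hc : (Prod.snd ∘ e ∘ proj (m + n) : (ℕ → A) → _) = proj n ∘ shift^[m] := by
      funext x j
      simp [e, proj, iterate_shift_apply, add_comm]
    rw [hc, ← Measure.map_map (measurable_proj n) (continuous_shift.iterate m).measurable,
      (measurePreserving_iterate_shift hinv m).map_eq]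
  have : IsProbabilityMeasure ((μ.map (proj (m + n))).map e) :=
    Measure.isProbabilityMeasure_map he.aemeasurable
  have key := klDiv_fst_add_klDiv_snd_le ((μ.map (proj (m + n))).map e)
    (Measure.pi fun _ : Fin m => p) (Measure.pi fun _ : Fin n => p)
  rw [h1, h2, ← hpi] at key
  exact key.trans (klDiv_map_le _ _ he)

lemma integrable_of_continuous {μ : Measure (ℕ → A)} [IsProbabilityMeasure μ] {g : (ℕ → A) → ℝ}
    (hg : Continuous g) : Integrable g μ := by
  obtain ⟨M, hM⟩ := isCompact_univ.exists_bound_of_continuousOn hg.continuousOn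
  exact Integrable.of_bound hg.aestronglyMeasurable M (.of_forall fun x => hM x (Set.mem_univ x))

lemma integral_comp_iterate_shift {μ : Measure (ℕ → A)} (hinv : μ.map shift = μ)
    {g : (ℕ → A) → ℝ} (hg : Continuous g) (k : ℕ) : ∫ x, g (shift^[k] x) ∂μ = ∫ x, g x ∂μ := by
  have h := (measurePreserving_iterate_shift hinv k).map_eq
  nth_rw 2 [← h]
  rw [integral_map (continuous_shift.iterate k).aemeasurable hg.aestronglyMeasurable]

lemma integral_birkhoff {μ : Measure (ℕ → A)} [IsProbabilityMeasure μ] (hinv : μ.map shift = μ)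
    {g : (ℕ → A) → ℝ} (hg : Continuous g) (n : ℕ) :
    ∫ x, birkhoff n g x ∂μ = n * ∫ x, g x ∂μ := by
  unfold birkhoff
  have hi : ∀ i ∈ Finset.range n, Integrable (fun x => g (shift^[i] x)) μ := fun i _ =>
    integrable_of_continuous (hg.comp (continuous_shift.iterate i))
  rw [integral_finsetSum _ hi]
  simp [integral_comp_iterate_shift hinv hg]

lemma tendsto_integral_logDensity (ν : Measure (ℕ → A)) [IsProbabilityMeasure ν]
    {g : (ℕ → A) → ℝ} (hg : Continuous g) (μ : Measure (ℕ → A)) [IsProbabilityMeasure μ]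
    (hinv : μ.map shift = μ) :
    Tendsto (fun n : ℕ => (n : ℝ)⁻¹ * ∫ x, logDensity ν g n (proj n x) ∂μ) atTop
      (nhds (∫ x, g x ∂μ)) := by
  refine Metric.tendsto_atTop.2 fun ε hε => ?_
  obtain ⟨C, hC⟩ := exists_forall_agree_abs_birkhoff_sub_le hg (half_pos hε)
  have hpt : ∀ n x, |logDensity ν g n (proj n x) - birkhoff n g x| ≤ n * (ε / 2) + C := by
    intro n x
    exact abs_log_integral_exp_sub_le ν (continuous_birkhoff_wordCons n hg (proj n x)).measurable fun y =>
      hC n _ _ fun i hi => wordCons_proj_apply hi x y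
  have hint : ∀ n, |∫ x, logDensity ν g n (proj n x) ∂μ - n * ∫ x, g x ∂μ|
      ≤ n * (ε / 2) + C := by
    intro n
    obtain ⟨M, hM⟩ := exists_bound_logDensity ν hg n
    have hi : Integrable (fun x => logDensity ν g n (proj n x)) μ :=
      Integrable.of_bound ((measurable_logDensity ν hg n).comp
        (measurable_proj n)).aestronglyMeasurable M (.of_forall fun x => hM _)
    rw [← integral_birkhoff hinv hg, ← integral_sub hi
      (integrable_of_continuous (continuous_birkhoff n hg))]
    simpa using norm_integral_le_of_norm_le_const (μ := μ)
      (f := fun x => logDensity ν g n (proj n x) - birkhoff n g x) (C := n * (ε / 2) + C)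
      (.of_forall (hpt n))
  obtain ⟨N, hN⟩ := exists_nat_gt (2 * C / ε)
  refine ⟨N + 1, fun n hn => ?_⟩
  have hn0 : (0 : ℝ) < n := by exact_mod_cast (by omega : 0 < n)
  have hnN : (N : ℝ) < n := by exact_mod_cast (by omega : N < n)
  have hCn : 2 * C < n * ε := (div_lt_iff₀ hε).1 (hN.trans hnN)
  have heq : (n : ℝ)⁻¹ * ∫ x, logDensity ν g n (proj n x) ∂μ - ∫ x, g x ∂μ
      = (∫ x, logDensity ν g n (proj n x) ∂μ - n * ∫ x, g x ∂μ) / n := by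
    field_simp
  rw [Real.dist_eq, heq, abs_div, abs_of_pos hn0, div_lt_iff₀ hn0]
  linarith [hint n]

end Measure

lemma continuous_fbar {f h : (ℕ → A) → ℝ} (hf : Continuous f) (hh : Continuous h)
    (hpos : ∀ x, 0 < h x) (lam : ℝ) : Continuous (fbar f h lam) := by
  have hl : Continuous fun x => Real.log (h x) := hh.log fun x => (hpos x).ne'
  exact ((hf.add hl).sub (hl.comp continuous_shift)).sub continuous_const

lemma inv_natCast_mul_coe_ennreal {n : ℕ} (hn : n ≠ 0) (a : ENNReal) :
    ((n : ℝ)⁻¹ : EReal) * (a : EReal) = ((a / n : ENNReal) : EReal) := by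
  have hpos : (0 : ℝ) < n := by exact_mod_cast Nat.pos_of_ne_zero hn
  have h1 : ((n : ENNReal)⁻¹ : ENNReal) = ENNReal.ofReal ((n : ℝ)⁻¹) := by
    rw [ENNReal.ofReal_inv_of_pos hpos, ENNReal.ofReal_natCast]
  rw [div_eq_mul_inv, EReal.coe_ennreal_mul, h1, EReal.coe_ennreal_ofReal,
    max_eq_left (inv_nonneg.2 hpos.le), EReal.coe_inv, mul_comm]

/-- For an `α`-Hölder potential `f` with eigendata `(λ, h)` of the
Ruelle operator, `f̄` the associated normalized potential and `ν` an eigenmeasure of the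
transpose of `L_{f̄}`, for every shift-invariant Borel probability measure `μ` the limit
`lim_n (1/n) H_{Λ_n}(μ|ν)` exists and equals `log λ - ∫ f dμ - h^s(μ)`. -/
theorem statement0
    (p : Measure A) [IsProbabilityMeasure p]
    (hsupp : ∀ U : Set A, IsOpen U → U.Nonempty → 0 < p U)
    (α : ℝ) (hα0 : 0 < α) (hα1 : α < 1)
    (f : (ℕ → A) → ℝ) (hf : IsHolder α f)
    (lam : ℝ) (hlam : 0 < lam)
    (h : (ℕ → A) → ℝ) (hh : IsHolder α h) (hpos : ∀ x, 0 < h x)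
    (heig : ∀ x, ruelle p f h x = lam * h x)
    (ν : Measure (ℕ → A)) [IsProbabilityMeasure ν]
    (hν : ∀ φ : (ℕ → A) → ℝ, Continuous φ →
      ∫ x, ruelle p (fbar f h lam) φ x ∂ν = ∫ x, φ x ∂ν)
    (μ : Measure (ℕ → A)) [IsProbabilityMeasure μ]
    (hinv : μ.map shift = μ) :
    Tendsto (fun n : ℕ => ((n : ℝ)⁻¹ : EReal) * relEntN n μ ν) atTop
      (nhds (((Real.log lam - ∫ x, f x ∂μ : ℝ) : EReal) - specEnt p μ)) := by
  have hfc := hf.continuous hα0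
  have hhc := hh.continuous hα0
  have hg := continuous_fbar hfc hhc hpos lam
  have : SecondCountableTopology A := EMetric.secondCountable_of_sigmaCompact A
  have hprob : ∀ k, IsProbabilityMeasure (μ.map (proj k)) := fun k =>
    Measure.isProbabilityMeasure_map (measurable_proj k).aemeasurable
  have hmean : ∫ x, fbar f h lam x ∂μ = ∫ x, f x ∂μ - Real.log lam := by
    have hl : Continuous fun x => Real.log (h x) := hhc.log fun x => (hpos x).ne'
    have hfi : Integrable f μ := integrable_of_continuous hfc
    have hli : Integrable (fun x => Real.log (h x)) μ := integrable_of_continuous hl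
    have hsi : Integrable (fun x => Real.log (h (shift x))) μ :=
      integrable_of_continuous (hl.comp continuous_shift)
    have hs : ∫ x, Real.log (h (shift x)) ∂μ = ∫ x, Real.log (h x) ∂μ :=
      integral_comp_iterate_shift hinv hl 1
    have h1 : Integrable (fun x => f x + Real.log (h x)) μ := hfi.add hli
    have h2 : Integrable (fun x => f x + Real.log (h x) - Real.log (h (shift x))) μ := h1.sub hsi
    unfold fbar
    rw [integral_sub h2 (integrable_const _), integral_sub h1 hsi, integral_add hfi hli, hs]
    simp
  obtain ⟨L, hL⟩ := tendsto_div_of_superadditive _ (klDiv_proj_add_le p μ hinv)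
  have hLE := (continuous_coe_ennreal_ereal.tendsto L).comp hL
  have hspec : specEnt p μ = -(L : EReal) := by
    refine Tendsto.limsup_eq ((hLE.neg).congr' ?_)
    filter_upwards [eventually_ne_atTop 0] with n hn
    rw [finEnt, relEnt_eq_klDiv, mul_neg, inv_natCast_mul_coe_ennreal hn]
    rfl
  have hlim := tendsto_integral_logDensity ν hg μ hinv
  have hlimE := (continuous_coe_real_ereal.tendsto _).comp hlim.neg
  rw [hmean, neg_sub] at hlimE
  rw [hspec, sub_eq_add_neg, neg_neg]
  have hadd := (EReal.continuousAt_add (p := (((Real.log lam - ∫ x, f x ∂μ : ℝ) : EReal),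
    (L : EReal))) (Or.inl (EReal.coe_ne_top _)) (Or.inl (EReal.coe_ne_bot _))).tendsto.comp
    (hlimE.prodMk_nhds hLE)
  refine hadd.congr' ?_
  filter_upwards [eventually_ne_atTop 0] with n hn
  rw [relEntN_eq p hg ν hν μ n, relEnt_eq_klDiv, ← EReal.coe_inv,
    EReal.left_distrib_of_nonneg_of_ne_top (by exact_mod_cast inv_nonneg.2 (Nat.cast_nonneg n))
      (EReal.coe_ne_top _), EReal.coe_inv, inv_natCast_mul_coe_ennreal hn, ← EReal.coe_inv,
    ← EReal.coe_mul, mul_neg, add_comm]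
  rfl

end Paper
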